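/- arXiv:1503.08090 — 7 statements merged into one kernel-verified Lean document; each statement's English description precedes it below -/
import Mathlib

section
/- For every i ∈ I, every real-valued w : P → ℝ and every p ∈ P, F♯_i(w)(p) ≤ F_i♭(w)(p) in ℝ̄. -/
open MvPolynomial Filter

noncomputable section

abbrev MvPoly (d : ℕ) := MvPolynomial (Fin d) ℝ

/-- `q` is a sum of squares of polynomials (`q ∈ Σ[x]`). -/
def IsSOS {d : ℕ} (q : MvPoly d) : Prop :=
  ∃ (n : ℕ) (g : Fin n → MvPoly d), q = ∑ j, g j ^ 2

/-- The map `ℝ^d → ℝ^d` whose components are the polynomials `T j`. -/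
def polyMapApply {d : ℕ} (T : Fin d → MvPoly d) (x : Fin d → ℝ) : Fin d → ℝ :=
  fun j => eval x (T j)

/-- Degree of a polynomial map: the maximum total degree of its components. -/
def degMap {d : ℕ} (T : Fin d → MvPoly d) : ℕ :=
  Finset.univ.sup fun j => (T j).totalDegree

/-- `ur : P → ℝ` is the real-valued representative of `u : P → ℝ̄`. -/
def RealRep {ιP : Type} (u : ιP → EReal) (ur : ιP → ℝ) : Prop :=
  ∀ p, Real.toEReal (ur p) = u p

/-- Context: a constrained piecewise discrete-time polynomial system together with
a finite basis of polynomial templates of degree at most `2m`. -/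
structure PPSCtx (d m : ℕ) (I ιP : Type) [Fintype I] [Fintype ιP] where
  nI : I → ℕ
  rI : (i : I) → Fin (nI i) → MvPoly d
  n0 : ℕ
  r0 : Fin n0 → MvPoly d
  nin : ℕ
  rin : Fin nin → MvPoly d
  T : I → Fin d → MvPoly d
  tmpl : ιP → MvPoly d
  htmpl : ∀ p, (tmpl p).totalDegree ≤ 2 * m

namespace PPSCtx

variable {d m : ℕ} {I ιP : Type} [Fintype I] [Fintype ιP] (S : PPSCtx d m I ιP)

def Xi (i : I) : Set (Fin d → ℝ) := {x | ∀ j, eval x (S.rI i j) ≤ 0}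

def X0 : Set (Fin d → ℝ) := {x | ∀ k, eval x (S.r0 k) ≤ 0}

def Xin : Set (Fin d → ℝ) := {x | ∀ j, eval x (S.rin j) ≤ 0}

def wStar (w : ιP → ℝ) : Set (Fin d → ℝ) := {x | ∀ p, eval x (S.tmpl p) ≤ w p}

/-- `F♯_i(w)(p)`. -/
def FsharpI (w : ιP → ℝ) (i : I) (p : ιP) : EReal :=
  ⨆ x ∈ S.wStar w ∩ S.Xi i ∩ S.X0,
    Real.toEReal (eval (polyMapApply (S.T i) x) (S.tmpl p))

/-- `X^in†(p)`. -/
def XinDag (p : ιP) : EReal :=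
  ⨆ x ∈ S.Xin, Real.toEReal (eval x (S.tmpl p))

/-- The SOS certificate constraints witnessing the bound `η` in `F_i♭(w)(p)`. -/
def FibWitness (w : ιP → ℝ) (i : I) (p : ιP) (η : ℝ) (lam : ιP → ℝ)
    (σ : MvPoly d) (μ : Fin (S.nI i) → MvPoly d) (γ : Fin S.n0 → MvPoly d) : Prop :=
  (∀ q, 0 ≤ lam q) ∧ IsSOS σ ∧ (∀ l, IsSOS (μ l)) ∧ (∀ l, IsSOS (γ l)) ∧
  (C η - aeval (S.T i) (S.tmpl p) - (∑ q, C (lam q) * (C (w q) - S.tmpl q))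
      + (∑ l, μ l * S.rI i l) + (∑ l, γ l * S.r0 l) = σ) ∧
  σ.totalDegree ≤ 2 * m * degMap (S.T i) ∧
  ((∑ l, μ l * S.rI i l) + (∑ l, γ l * S.r0 l)).totalDegree ≤ 2 * m * degMap (S.T i)

/-- `F_i♭(w)(p)`. -/
def Fib (w : ιP → ℝ) (i : I) (p : ιP) : EReal :=
  sInf (Real.toEReal '' {η : ℝ | ∃ lam σ μ γ, S.FibWitness w i p η lam σ μ γ})

/-- `X^in♭(p)`. -/
def Xinb (p : ιP) : EReal :=
  sInf (Real.toEReal '' {η : ℝ | ∃ (σ₀ : MvPoly d) (ν : Fin S.nin → MvPoly d),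
    IsSOS σ₀ ∧ (∀ j, IsSOS (ν j)) ∧
    (C η - S.tmpl p + ∑ j, ν j * S.rin j = σ₀) ∧
    σ₀.totalDegree ≤ 2 * m ∧ (∑ j, ν j * S.rin j).totalDegree ≤ 2 * m})

/-- `F♭(w)(p)`. -/
def Fb (w : ιP → ℝ) (p : ιP) : EReal :=
  max (⨆ i, S.Fib w i p) (S.Xinb p)

/-- `Sol(w,i,p)`: feasible tuples attaining the infimum `F_i♭(w)(p)`. -/
def Sol (w : ιP → ℝ) (i : I) (p : ιP) (lam : ιP → ℝ)
    (σ : MvPoly d) (μ : Fin (S.nI i) → MvPoly d) (γ : Fin S.n0 → MvPoly d) : Prop :=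
  ∃ η : ℝ, S.FibWitness w i p η lam σ μ γ ∧ Real.toEReal η = S.Fib w i p

/-- `FS`: template bounds for which `Sol(w,i,p)` is nonempty for all `i`, `p`. -/
def FS (w : ιP → ℝ) : Prop :=
  ∀ (i : I) (p : ιP), ∃ lam σ μ γ, S.Sol w i p lam σ μ γ

/-- `lamP` is the `λ`-part of a policy choice `π(w)`. -/
def IsPolicy (w : ιP → ℝ) (lamP : I → ιP → ιP → ℝ) : Prop :=
  ∀ (i : I) (p : ιP), ∃ σ μ γ, S.Sol w i p (lamP i p) σ μ γ

/-- `φ_{w,i,p}^λ(v)` for `v : P → ℝ̄`. -/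
def phiE (w : ιP → ℝ) (lam : ιP → ℝ) (i : I) (p : ιP) (v : ιP → EReal) : EReal :=
  (∑ q, Real.toEReal (lam q) * v q) + S.Fib w i p - Real.toEReal (∑ q, lam q * w q)

/-- `Φ_w^{π(w)}(v)(p)`. -/
def PhiE (w : ιP → ℝ) (lamP : I → ιP → ιP → ℝ) (v : ιP → EReal) (p : ιP) : EReal :=
  max (⨆ i, S.phiE w (lamP i p) i p v) (S.Xinb p)

/-- The least fixpoint of `Φ_w^{π(w)}` on the complete lattice `P → ℝ̄`
(by the Knaster–Tarski theorem, the infimum of the post-fixpoints). -/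
def lfpPhi (w : ιP → ℝ) (lamP : I → ιP → ιP → ℝ) : ιP → EReal :=
  sInf {v : ιP → EReal | ∀ p, S.PhiE w lamP v p ≤ v p}

/-- The policy iteration sequence. -/
def IsPolicySeq (W : ℕ → ιP → EReal) : Prop :=
  (∃ w0 : ιP → ℝ, RealRep (W 0) w0 ∧ ∀ p, S.Fb w0 p ≤ Real.toEReal (w0 p)) ∧
  (∀ p, ∃ r : ℝ, S.Xinb p = Real.toEReal r) ∧
  (∀ k : ℕ,
    (∀ wr : ιP → ℝ, RealRep (W k) wr → S.FS wr →
      ∃ lamP, S.IsPolicy wr lamP ∧ W (k + 1) = S.lfpPhi wr lamP) ∧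
    ((¬ ∃ wr : ιP → ℝ, RealRep (W k) wr ∧ S.FS wr) → W (k + 1) = W k))

end PPSCtx

theorem IsSOS.eval_nonneg {d : ℕ} {q : MvPoly d} (h : IsSOS q) (x : Fin d → ℝ) :
    0 ≤ eval x q := by
  obtain ⟨n, g, rfl⟩ := h
  simp only [map_sum, map_pow]
  exact Finset.sum_nonneg fun j _ => sq_nonneg _

theorem eval_aeval_eq_eval_polyMapApply {d : ℕ} (T : Fin d → MvPoly d) (q : MvPoly d)
    (x : Fin d → ℝ) : eval x (aeval T q) = eval (polyMapApply T x) q := by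
  induction q using MvPolynomial.induction_on with
  | C a => simp
  | add a b ha hb => rw [map_add, map_add, map_add, ha, hb]
  | mul_X a j ha => rw [map_mul, map_mul, map_mul, ha, aeval_X, eval_X, polyMapApply]

theorem eval_sum_sos_mul_nonpos {d n : ℕ} {μ r : Fin n → MvPoly d} {x : Fin d → ℝ}
    (hμ : ∀ l, IsSOS (μ l)) (hr : ∀ l, eval x (r l) ≤ 0) :
    eval x (∑ l, μ l * r l) ≤ 0 := by
  simp only [map_sum, map_mul]
  exact Finset.sum_nonpos fun l _ =>
    mul_nonpos_of_nonneg_of_nonpos ((hμ l).eval_nonneg x) (hr l)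

/-- safety, part 2 of Prop. 2: `F♯_i(w)(p) ≤ F_i♭(w)(p)`. -/
theorem stmt5 {d m : ℕ} {I ιP : Type} [Fintype I] [Fintype ιP]
    (S : PPSCtx d m I ιP) (w : ιP → ℝ) (i : I) (p : ιP) :
    S.FsharpI w i p ≤ S.Fib w i p := by
  refine iSup₂_le fun x hx => le_sInf ?_
  rintro _ ⟨η, ⟨lam, σ, μ, γ, hlam, hσ, hμ, hγ, heq, -, -⟩, rfl⟩
  obtain ⟨⟨hw, hXi⟩, hX0⟩ := hx
  have hμr := eval_sum_sos_mul_nonpos hμ hXi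
  have hγr := eval_sum_sos_mul_nonpos hγ hX0
  have hsum : 0 ≤ eval x (∑ q, C (lam q) * (C (w q) - S.tmpl q)) := by
    simp only [map_sum, map_mul, map_sub, eval_C]
    exact Finset.sum_nonneg fun q _ => mul_nonneg (hlam q) (sub_nonneg.2 (hw q))
  have hσx := hσ.eval_nonneg x
  rw [← heq, map_add, map_add, map_sub, map_sub, eval_C,
    eval_aeval_eq_eval_polyMapApply] at hσx
  exact EReal.coe_le_coe_iff.2 (by linarith)
end
end

section
/- For every i ∈ I, the map w ↦ F_i♭(w) is monotone: if w, w' : P → ℝ satisfy w(q) ≤ w'(q) for all q ∈ P, then F_i♭(w)(p) ≤ F_i♭(w')(p) for all p ∈ P. -/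
open MvPolynomial Filter

noncomputable section

/-- monotonicity, part 1 of Prop. 3: each `w ↦ F_i♭(w)` is monotone. -/
theorem stmt7 {d m : ℕ} {I ιP : Type} [Fintype I] [Fintype ιP]
    (S : PPSCtx d m I ιP) (i : I) (w w' : ιP → ℝ)
    (h : ∀ q, w q ≤ w' q) (p : ιP) :
    S.Fib w i p ≤ S.Fib w' i p := by
  refine le_sInf ?_
  rintro _ ⟨η, ⟨lam, σ, μ, γ, hlam, hσ, hμ, hγ, heq, hdσ, hdr⟩, rfl⟩
  have hgap : 0 ≤ ∑ q, lam q * (w' q - w q) :=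
    Finset.sum_nonneg fun q _ => mul_nonneg (hlam q) (sub_nonneg.2 (h q))
  have hle : η - ∑ q, lam q * (w' q - w q) ≤ η := sub_le_self _ hgap
  refine le_trans (sInf_le (Set.mem_image_of_mem _ ?_)) (EReal.coe_le_coe_iff.2 hle)
  refine ⟨lam, σ, μ, γ, hlam, hσ, hμ, hγ, ?_, hdσ, hdr⟩
  have hsum : (∑ q, C (lam q) * (C (w' q) - S.tmpl q)) =
      C (∑ q, lam q * (w' q - w q)) + ∑ q, C (lam q) * (C (w q) - S.tmpl q) := by
    rw [map_sum, ← Finset.sum_add_distrib]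
    refine Finset.sum_congr rfl fun q _ => ?_
    rw [C_mul, C_sub]
    ring
  rw [← heq, hsum, C_sub]
  ring
end
end

section
/- The map w ↦ F♭(w) is monotone: if w, w' : P → ℝ satisfy w(q) ≤ w'(q) for all q ∈ P, then F♭(w)(p) ≤ F♭(w')(p) for all p ∈ P, where F♭(w)(p) = max(max_{i∈I} F_i♭(w)(p), X^in♭(p)). -/
open MvPolynomial Filter

noncomputable section

/-- A certificate for the bounds `w'` is also a certificate for any `w`, with its value lowered
by `∑ q, lam q * (w' q - w q)`. -/
theorem PPSCtx.FibWitness.sub_sum {d m : ℕ} {I ιP : Type} [Fintype I] [Fintype ιP]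
    {S : PPSCtx d m I ιP} {w' : ιP → ℝ} {i : I} {p : ιP} {η : ℝ} {lam : ιP → ℝ}
    {σ : MvPoly d} {μ : Fin (S.nI i) → MvPoly d} {γ : Fin S.n0 → MvPoly d}
    (hw : S.FibWitness w' i p η lam σ μ γ) (w : ιP → ℝ) :
    S.FibWitness w i p (η - ∑ q, lam q * (w' q - w q)) lam σ μ γ := by
  obtain ⟨hlam, hσ, hμ, hγ, heq, hdeg⟩ := hw
  refine ⟨hlam, hσ, hμ, hγ, ?_, hdeg⟩
  rw [← heq]
  simp only [map_sub, map_sum, map_mul, mul_sub, Finset.sum_sub_distrib]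
  ring

theorem PPSCtx.Fib_mono {d m : ℕ} {I ιP : Type} [Fintype I] [Fintype ιP]
    (S : PPSCtx d m I ιP) {w w' : ιP → ℝ} (h : ∀ q, w q ≤ w' q) (i : I) (p : ιP) :
    S.Fib w i p ≤ S.Fib w' i p := by
  refine le_sInf ?_
  rintro _ ⟨η, ⟨lam, σ, μ, γ, hw⟩, rfl⟩
  have hle : S.Fib w i p ≤ Real.toEReal (η - ∑ q, lam q * (w' q - w q)) :=
    sInf_le ⟨_, ⟨lam, σ, μ, γ, hw.sub_sum w⟩, rfl⟩
  exact hle.trans <| EReal.coe_le_coe_iff.2 <| sub_le_self _ <|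
    Finset.sum_nonneg fun q _ => mul_nonneg (hw.1 q) (sub_nonneg.2 (h q))

/-- monotonicity, part 2 of Prop. 3: `w ↦ F♭(w)` is monotone. -/
theorem stmt8 {d m : ℕ} {I ιP : Type} [Fintype I] [Fintype ιP]
    (S : PPSCtx d m I ιP) (w w' : ιP → ℝ)
    (h : ∀ q, w q ≤ w' q) (p : ιP) :
    S.Fb w p ≤ S.Fb w' p := by
  exact max_le_max (iSup_mono fun i => S.Fib_mono h i p) le_rfl
end
end

section
/- Let w : P → ℝ, i ∈ I, p ∈ P with F_i♭(w)(p) ∈ ℝ, and let (λ,σ,μ,γ) ∈ Sol(w,i,p). Define φ(v) = Σ_{q∈P} λ(q)·v(q) + F_i♭(w)(p) − Σ_{q∈P} λ(q)·w(q) for v : P → ℝ. Then for every v : P → ℝ, F_i♭(v)(p) ≤ φ(v). -/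
open MvPolynomial Filter

noncomputable section

/-- part 3 of Prop. 4: for any optimal solution `(λ,σ,μ,γ) ∈ Sol(w,i,p)`,
the affine map `φ(v) = Σ_q λ(q)v(q) + F_i♭(w)(p) − Σ_q λ(q)w(q)` dominates `F_i♭(·)(p)`. -/
theorem stmt10 {d m : ℕ} {I ιP : Type} [Fintype I] [Fintype ιP]
    (S : PPSCtx d m I ιP) (w : ιP → ℝ) (i : I) (p : ιP)
    (lam : ιP → ℝ) (σ : MvPoly d) (μ : Fin (S.nI i) → MvPoly d) (γ : Fin S.n0 → MvPoly d)
    (hsol : S.Sol w i p lam σ μ γ)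
    (c : ℝ) (hc : Real.toEReal c = S.Fib w i p) (v : ιP → ℝ) :
    S.Fib v i p ≤ Real.toEReal ((∑ q, lam q * v q) + c - ∑ q, lam q * w q) := by
  obtain ⟨η, ⟨hlam, hσ, hμ, hγ, hid, hdσ, hdr⟩, hη⟩ := hsol
  obtain rfl : η = c := EReal.coe_injective (hη.trans hc.symm)
  refine sInf_le ⟨_, ⟨lam, σ, μ, γ, hlam, hσ, hμ, hγ, ?_, hdσ, hdr⟩, rfl⟩
  rw [← hid]
  simp only [mul_sub, Finset.sum_sub_distrib, map_add, map_sub, map_sum, map_mul]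
  ring
end
end

section
/- Let w ∈ FS with a policy choice π(w). Then F♭(v)(p) ≤ Φ_w^{π(w)}(v)(p) for every v : P → ℝ and every p ∈ P, where F♭(v)(p) = max(max_{i∈I} F_i♭(v)(p), X^in♭(p)). -/
open MvPolynomial Filter

noncomputable section

namespace PPSCtx

variable {d m : ℕ} {I ιP : Type} [Fintype I] [Fintype ιP] {S : PPSCtx d m I ιP}

/-- Shifting the template bounds from `w` to `v` shifts a certified bound by `Σ λ (v - w)`. -/
theorem FibWitness.shift {w : ιP → ℝ} {i : I} {p : ιP} {η : ℝ} {lam : ιP → ℝ}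
    {σ : MvPoly d} {μ : Fin (S.nI i) → MvPoly d} {γ : Fin S.n0 → MvPoly d}
    (h : S.FibWitness w i p η lam σ μ γ) (v : ιP → ℝ) :
    S.FibWitness v i p ((∑ q, lam q * v q) + η - ∑ q, lam q * w q) lam σ μ γ := by
  obtain ⟨hlam, hσ, hμ, hγ, hid, hdσ, hdr⟩ := h
  refine ⟨hlam, hσ, hμ, hγ, ?_, hdσ, hdr⟩
  rw [← hid]
  simp only [map_sub, map_add, map_sum, map_mul, mul_sub, Finset.sum_sub_distrib]
  ring

theorem Fib_le_of_FibWitness {w : ιP → ℝ} {i : I} {p : ιP} {η : ℝ} {lam : ιP → ℝ}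
    {σ : MvPoly d} {μ : Fin (S.nI i) → MvPoly d} {γ : Fin S.n0 → MvPoly d}
    (h : S.FibWitness w i p η lam σ μ γ) : S.Fib w i p ≤ Real.toEReal η :=
  sInf_le ⟨η, ⟨lam, σ, μ, γ, h⟩, rfl⟩

theorem phiE_coe {w : ιP → ℝ} {i : I} {p : ιP} {η : ℝ}
    (hη : Real.toEReal η = S.Fib w i p) (lam v : ιP → ℝ) :
    S.phiE w lam i p (fun q => Real.toEReal (v q)) =
      Real.toEReal ((∑ q, lam q * v q) + η - ∑ q, lam q * w q) := by
  have hsum : ∑ q, Real.toEReal (lam q) * Real.toEReal (v q) =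
      Real.toEReal (∑ q, lam q * v q) := by
    simp only [← EReal.coe_mul]
    exact (map_sum (⟨⟨Real.toEReal, EReal.coe_zero⟩, EReal.coe_add⟩ : ℝ →+ EReal) _ _).symm
  rw [phiE, hsum, ← hη, EReal.coe_sub, EReal.coe_add]

end PPSCtx

/-- part 2 of Prop. 5: `F♭(v) ≤ Φ_w^{π(w)}(v)` for all real-valued `v`. -/
theorem stmt12 {d m : ℕ} {I ιP : Type} [Fintype I] [Fintype ιP]
    (S : PPSCtx d m I ιP) (w : ιP → ℝ) (hFS : S.FS w)
    (lamP : I → ιP → ιP → ℝ) (hpol : S.IsPolicy w lamP)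
    (v : ιP → ℝ) (p : ιP) :
    S.Fb v p ≤ S.PhiE w lamP (fun q => Real.toEReal (v q)) p := by
  refine max_le_max (iSup_mono fun i => ?_) le_rfl
  obtain ⟨σ, μ, γ, η, hwit, hη⟩ := hpol i p
  rw [PPSCtx.phiE_coe hη]
  exact PPSCtx.Fib_le_of_FibWitness (hwit.shift v)
end
end

section
/- Let w ∈ FS with a policy choice π(w), and suppose the least fixpoint L of Φ_w^{π(w)} on the complete lattice of functions P → ℝ̄ (which exists by the Knaster–Tarski theorem, Φ_w^{π(w)} being monotone) is real-valued. Then L is a feasible point of the linear program: minimize Σ_{p'∈P} v(p') over v : P → ℝ subject to φ_{w,i,p}^{π_λ(w)(i,p)}(v) ≤ v(p) for all (i,p) ∈ I×P and X^in♭(q) ≤ v(q) for all q ∈ P; moreover every feasible v satisfies Σ_{p'∈P} L(p') ≤ Σ_{p'∈P} v(p'), and L is the unique feasible point attaining this minimum. -/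
open MvPolynomial Filter

noncomputable section

theorem PPSCtx.phiE_mono {d m : ℕ} {I ιP : Type} [Fintype I] [Fintype ιP]
    (S : PPSCtx d m I ιP) (w lam : ιP → ℝ) (hlam : ∀ q, 0 ≤ lam q) (i : I) (p : ιP) :
    Monotone (S.phiE w lam i p) := fun _ _ huv =>
  EReal.sub_le_sub
    (add_le_add_left (Finset.sum_le_sum fun q _ =>
      mul_le_mul_of_nonneg_left (huv q) (EReal.coe_nonneg.2 (hlam q))) _) le_rfl

theorem PPSCtx.PhiE_mono {d m : ℕ} {I ιP : Type} [Fintype I] [Fintype ιP]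
    (S : PPSCtx d m I ιP) (w : ιP → ℝ) (lamP : I → ιP → ιP → ℝ)
    (hlam : ∀ i p q, 0 ≤ lamP i p q) : Monotone (S.PhiE w lamP) := fun _ _ huv p =>
  max_le_max (iSup_mono fun i => S.phiE_mono w (lamP i p) (hlam i p) i p huv) le_rfl

/-- The infimum of the post-fixpoints is itself a post-fixpoint. -/
theorem PPSCtx.PhiE_lfpPhi_le {d m : ℕ} {I ιP : Type} [Fintype I] [Fintype ιP]
    (S : PPSCtx d m I ιP) (w : ιP → ℝ) (lamP : I → ιP → ιP → ℝ)
    (hlam : ∀ i p q, 0 ≤ lamP i p q) :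
    S.PhiE w lamP (S.lfpPhi w lamP) ≤ S.lfpPhi w lamP :=
  le_sInf fun _ hv => (S.PhiE_mono w lamP hlam (sInf_le hv)).trans hv

/-- part 4 of Prop. 5: if the least fixpoint `L` of `Φ_w^{π(w)}` is
real-valued, then it is the unique optimal solution of the linear program
`min Σ_{p'} v(p')` subject to `φ_{w,i,p}(v) ≤ v(p)` and `X^in♭(q) ≤ v(q)`. -/
theorem stmt13 {d m : ℕ} {I ιP : Type} [Fintype I] [Fintype ιP]
    (S : PPSCtx d m I ιP) (w : ιP → ℝ) (hFS : S.FS w)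
    (lamP : I → ιP → ιP → ℝ) (hpol : S.IsPolicy w lamP)
    (Lr : ιP → ℝ) (hLr : RealRep (S.lfpPhi w lamP) Lr) :
    let Feas : (ιP → ℝ) → Prop := fun v =>
      (∀ (i : I) (p : ιP),
          S.phiE w (lamP i p) i p (fun q => Real.toEReal (v q)) ≤ Real.toEReal (v p)) ∧
      (∀ q : ιP, S.Xinb q ≤ Real.toEReal (v q))
    Feas Lr ∧ (∀ v : ιP → ℝ, Feas v → ∑ p', Lr p' ≤ ∑ p', v p') ∧
      (∀ v : ιP → ℝ, Feas v → (∑ p', v p') = (∑ p', Lr p') → v = Lr) := by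
  intro Feas
  have hlam : ∀ i p q, 0 ≤ lamP i p q := fun i p => by
    obtain ⟨_, _, _, _, hwit, _⟩ := hpol i p
    exact hwit.1
  have hL : (fun q => Real.toEReal (Lr q)) = S.lfpPhi w lamP := funext hLr
  have hle : ∀ v : ιP → ℝ, Feas v → ∀ p, Lr p ≤ v p := fun v hv p => by
    have hmem : S.lfpPhi w lamP ≤ fun q => Real.toEReal (v q) :=
      sInf_le fun q => max_le (iSup_le fun i => hv.1 i q) (hv.2 q)
    have := hmem p
    rw [← hLr p] at this
    exact EReal.coe_le_coe_iff.1 this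
  have hpost := S.PhiE_lfpPhi_le w lamP hlam
  rw [← hL] at hpost
  refine ⟨⟨fun i p => ?_, fun q => (le_max_right _ _).trans (hpost q)⟩,
    fun v hv => Finset.sum_le_sum fun p _ => hle v hv p, fun v hv hsum => ?_⟩
  · exact (le_iSup (fun i => S.phiE w (lamP i p) i p fun q => Real.toEReal (Lr q)) i).trans
      ((le_max_left _ _).trans (hpost p))
  · funext p
    exact ((Finset.sum_eq_sum_iff_of_le fun p _ => hle v hv p).1 hsum.symm p
      (Finset.mem_univ p)).symm
end
end

section
/- Let p ∈ P and let w ∈ FS. Then w ↦ F♭(w)(p) is upper semicontinuous at w on real-valued template bounds: for every sequence (w_n) of functions P → ℝ converging pointwise to w, limsup_{n→∞} F♭(w_n)(p) ≤ F♭(w)(p) in ℝ̄. -/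
open MvPolynomial Filter

noncomputable section

/-- An optimal certificate at `w` with multipliers `lam` gives at `w'` an affine upper bound on
`F_i♭`. -/
theorem PPSCtx.FibWitness.fib_le {d m : ℕ} {I ιP : Type} [Fintype I] [Fintype ιP]
    {S : PPSCtx d m I ιP} {w : ιP → ℝ} {i : I} {p : ιP} {η : ℝ} {lam : ιP → ℝ}
    {σ : MvPoly d} {μ : Fin (S.nI i) → MvPoly d} {γ : Fin S.n0 → MvPoly d}
    (h : S.FibWitness w i p η lam σ μ γ) (w' : ιP → ℝ) :
    S.Fib w' i p ≤ Real.toEReal (η + ∑ q, lam q * (w' q - w q)) := by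
  obtain ⟨hlam, hσ, hμ, hγ, heq, hdeg⟩ := h
  refine sInf_le ⟨_, ⟨lam, σ, μ, γ, hlam, hσ, hμ, hγ, ?_, hdeg⟩, rfl⟩
  rw [← heq]
  simp only [map_add, map_sum, map_mul, map_sub, mul_sub, Finset.sum_sub_distrib]
  ring

/-- upper semicontinuity of `F♭(·)(p)` on `FS` for real-valued bounds. -/
theorem stmt14 {d m : ℕ} {I ιP : Type} [Fintype I] [Fintype ιP]
    (S : PPSCtx d m I ιP) (p : ιP) (w : ιP → ℝ) (hFS : S.FS w)
    (wn : ℕ → ιP → ℝ)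
    (hconv : ∀ q, Filter.Tendsto (fun n => wn n q) Filter.atTop (nhds (w q))) :
    Filter.limsup (fun n => S.Fb (wn n) p) Filter.atTop ≤ S.Fb w p := by
  choose lam σ μ γ η hwit hη using fun i => hFS i p
  have htend (i : I) : Tendsto
      (fun n => Real.toEReal (η i + ∑ q, lam i q * (wn n q - w q))) atTop
      (nhds (S.Fib w i p)) := by
    rw [← hη i]
    refine (continuous_coe_real_ereal.tendsto _).comp ?_
    simpa using (tendsto_finsetSum Finset.univ fun q _ =>
      ((hconv q).sub_const (w q)).const_mul (lam i q)).const_add (η i)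
  have hlim : Tendsto
      (fun n => max (⨆ i, Real.toEReal (η i + ∑ q, lam i q * (wn n q - w q))) (S.Xinb p))
      atTop (nhds (S.Fb w p)) := by
    refine Tendsto.max ?_ tendsto_const_nhds
    simp only [← Finset.sup_univ_eq_iSup]
    exact Tendsto.finset_sup_nhds_apply fun i _ => htend i
  rw [← hlim.limsup_eq]
  exact limsup_le_limsup (Eventually.of_forall fun n =>
    max_le_max_right _ (iSup_mono fun i => (hwit i).fib_le (wn n)))
end
end
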